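/- Let a be a C¹-smooth boundary point of a ℂ-convex domain D ⊆ ℂ^n. Then ∂D contains no nontrivial analytic disc through a if and only if L_a = {0}; that is, there exists a nonconstant holomorphic map φ : 𝔻 → ∂D with φ(0) = a if and only if there exists a nonzero vector X ∈ ℂ^n and ε > 0 with {a + λX : |λ| < ε} ⊆ ∂D. -/

import Mathlib

open Complex Metric Set MeasureTheory

noncomputable section

/-- `ℂ^n` with the Euclidean (Hermitian) structure. -/
abbrev Cn (n : ℕ) := EuclideanSpace ℂ (Fin n)

instance (n : ℕ) : MeasurableSpace (Cn n) := borel _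
instance (n : ℕ) : BorelSpace (Cn n) := ⟨rfl⟩

/-- The complex affine line through `z` in direction `X`. -/
def cline {n : ℕ} (z X : Cn n) : Set (Cn n) := {w | ∃ l : ℂ, w = z + l • X}

/-- A domain: a nonempty connected open set. -/
def IsDomain' {n : ℕ} (D : Set (Cn n)) : Prop := IsOpen D ∧ IsConnected D

/-- `D` is ℂ-convex: its intersection with every complex affine line is, when
nonempty, connected and simply connected. -/
def IsCConvex {n : ℕ} (D : Set (Cn n)) : Prop :=
  ∀ z X : Cn n, X ≠ 0 → (D ∩ cline z X).Nonempty →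
    IsConnected (D ∩ cline z X) ∧ SimplyConnectedSpace ↥(D ∩ cline z X)

/-- The Carathéodory metric `γ_D(z;X)`. -/
def caraMetric {n : ℕ} (D : Set (Cn n)) (z X : Cn n) : ℝ :=
  sSup {r : ℝ | ∃ f : Cn n → ℂ, DifferentiableOn ℂ f D ∧ MapsTo f D (ball (0:ℂ) 1) ∧
    f z = 0 ∧ r = ‖fderiv ℂ f z X‖}

/-- The Kobayashi metric `κ_D(z;X)`. -/
def kobMetric {n : ℕ} (D : Set (Cn n)) (z X : Cn n) : ℝ :=
  sInf {a : ℝ | 0 ≤ a ∧ ∃ φ : ℂ → Cn n, DifferentiableOn ℂ φ (ball (0:ℂ) 1) ∧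
    MapsTo φ (ball (0:ℂ) 1) D ∧ φ 0 = z ∧ a • (fderiv ℂ φ 0 1) = X}

/-- The distance `d_D(z,X)` from `z` to `∂D` in direction `X`. -/
def dirDist {n : ℕ} (D : Set (Cn n)) (z X : Cn n) : ℝ :=
  sSup {r : ℝ | 0 < r ∧ ∀ l : ℂ, ‖l‖ < r → z + l • X ∈ D}

/-- The Euclidean distance `d_D(z)` from `z` to `∂D`. -/
def bdist {n : ℕ} (D : Set (Cn n)) (z : Cn n) : ℝ := Metric.infDist z (frontier D)

/-- `L_a`: the set of vectors `X` such that a disc `{a + λX : |λ| < ε}` lies in `∂D`. -/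
def La {n : ℕ} (D : Set (Cn n)) (a : Cn n) : Set (Cn n) :=
  {X | ∃ ε > (0:ℝ), ∀ l : ℂ, ‖l‖ < ε → a + l • X ∈ frontier D}

/-- `D` contains no complex affine line. -/
def NoComplexLine {n : ℕ} (D : Set (Cn n)) : Prop :=
  ¬ ∃ z X : Cn n, X ≠ 0 ∧ cline z X ⊆ D

/-- The Bergman kernel `K_D(z)` (restricted to the diagonal). -/
def bergmanKernel {n : ℕ} (D : Set (Cn n)) (z : Cn n) : ℝ :=
  sSup {r : ℝ | ∃ f : Cn n → ℂ, DifferentiableOn ℂ f D ∧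
    IntegrableOn (fun w => ‖f w‖ ^ 2) D ∧ (∫ w in D, ‖f w‖ ^ 2) ≤ 1 ∧ r = ‖f z‖ ^ 2}

/-- `M_D(z;X)`. -/
def bergmanM {n : ℕ} (D : Set (Cn n)) (z X : Cn n) : ℝ :=
  sSup {r : ℝ | ∃ f : Cn n → ℂ, DifferentiableOn ℂ f D ∧
    IntegrableOn (fun w => ‖f w‖ ^ 2) D ∧ (∫ w in D, ‖f w‖ ^ 2) = 1 ∧
    f z = 0 ∧ r = ‖fderiv ℂ f z X‖}

/-- The Bergman metric `B_D(z;X) = M_D(z;X)/√K_D(z)`. -/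
def bergmanMetric {n : ℕ} (D : Set (Cn n)) (z X : Cn n) : ℝ :=
  bergmanM D z X / Real.sqrt (bergmanKernel D z)

/-- `G` is weakly linearly convex: through every boundary point there is a complex
affine hyperplane missing `G`. -/
def WeaklyLinConvex {n : ℕ} (G : Set (Cn n)) : Prop :=
  ∀ a ∈ frontier G, ∃ ℓ : Cn n →L[ℂ] ℂ, ℓ ≠ 0 ∧ ∀ z ∈ G, ℓ z ≠ ℓ a

/-- `d_{j,D}(z)` from the minimal-distance construction: the distance from `z` to the
boundary of the slice of `D` by the affine subspace `z + span{v_i : i ≥ j}`. -/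
def sliceDist {n : ℕ} (D : Set (Cn n)) (z : Cn n) (v : Fin n → Cn n) (j : Fin n) : ℝ :=
  sSup {r : ℝ | 0 < r ∧
    ∀ w ∈ Submodule.span ℂ (v '' {i | j ≤ i}), ‖w‖ < r → z + w ∈ D}

/-- The data `(v j)` is an admissible output of the minimal-distance construction at `z`:
the directions are orthonormal and each `v j` realizes the distance `d_{j,D}(z)` to the
boundary of the corresponding slice. -/
def MinimalBasis {n : ℕ} (D : Set (Cn n)) (z : Cn n) (v : Fin n → Cn n) : Prop :=
  Orthonormal ℂ v ∧ ∀ j : Fin n, z + (sliceDist D z v j) • v j ∉ D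



/-- A continuous function on a preconnected space with constant exponential is constant. -/
lemma eq_of_continuous_of_exp_eq {X : Type*} [TopologicalSpace X] [PreconnectedSpace X]
    {f : X → ℂ} (hf : Continuous f) (h : ∀ x y, Complex.exp (f x) = Complex.exp (f y)) (x y : X) :
    f x = f y :=
  Complex.isCoveringMap_exp.const_of_comp hf (fun a b => Subtype.ext (h a b)) x y

/-- There is no open family of simply connected sets `Ω c ⊆ ℂ \ {0}`, parametrized by a circle
`‖c‖ = R`, such that both `s` and `c⁻¹` belong to `Ω c` for every `c`. -/
lemma not_forall_isSimplyConnected_of_mem_inv (Ω : ℂ → Set ℂ) {s : ℂ} {R : ℝ} (hR : 0 < R)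
    (hopen : IsOpen {q : ℂ × ℂ | q.2 ∈ Ω q.1}) (h0 : ∀ c, 0 ∉ Ω c)
    (h1 : ∀ c : ℂ, ‖c‖ = R → s ∈ Ω c) (h2 : ∀ c : ℂ, ‖c‖ = R → c⁻¹ ∈ Ω c)
    (hsc : ∀ c : ℂ, ‖c‖ = R → IsSimplyConnected (Ω c)) : False := by
  have hΩ : ∀ c, IsOpen (Ω c) := fun c =>
    hopen.preimage (f := fun z : ℂ => (c, z)) (by fun_prop)
  have hlog : ∀ c : ℂ, ‖c‖ = R → ∃ f : ℂ → ℂ, ContinuousOn f (Ω c) ∧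
      ∀ z ∈ Ω c, Complex.exp (f z) = z := by
    intro c hc
    obtain ⟨f, hf, hf'⟩ := Complex.exists_continuousOn_eqOn_exp_comp (hsc c hc) (hΩ c)
      continuousOn_id (by simpa using h0 c)
    exact ⟨f, hf, fun z hz => hf' hz⟩
  choose! L hLc hL using hlog
  set c : ℝ → ℂ := fun θ => R * Complex.exp (θ * I) with hc
  have hcc : Continuous c := by fun_prop
  have hcR : ∀ θ, ‖c θ‖ = R := fun θ => by
    simp [hc, Complex.norm_exp_ofReal_mul_I, abs_of_pos hR]
  have hcinv : ∀ θ, (c θ)⁻¹ = (R : ℂ)⁻¹ * Complex.exp (-(θ * I)) := fun θ => by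
    simp [hc, Complex.exp_neg, mul_comm]
  set k : ℝ → ℂ := fun θ => L (c θ) s - L (c θ) (c θ)⁻¹ - θ * I with hk
  have hkconst : IsLocallyConstant k := by
    rw [IsLocallyConstant.iff_eventually_eq]
    intro θ₀
    obtain ⟨γ, hγ⟩ := (hsc _ (hcR θ₀)).isPathConnected.joinedIn s (h1 _ (hcR θ₀)) _
      (h2 _ (hcR θ₀))
    set Γ : ℝ → unitInterval → ℂ :=
      fun θ t => γ t * Complex.exp (-(((θ - θ₀ : ℝ) : ℂ) * (t : ℝ) * I)) with hΓ
    have hev : ∀ᶠ θ in nhds θ₀, ∀ t ∈ (univ : Set unitInterval), Γ θ t ∈ Ω (c θ) := by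
      apply isCompact_univ.eventually_forall_of_forall_eventually
      intro t _
      have : IsOpen {z : ℝ × unitInterval | Γ z.1 z.2 ∈ Ω (c z.1)} :=
        hopen.preimage (f := fun z : ℝ × unitInterval => (c z.1, Γ z.1 z.2)) (by fun_prop)
      exact this.mem_nhds (by simpa [hΓ] using hγ t)
    filter_upwards [hev] with θ hθ
    have hF : Continuous fun t : unitInterval =>
        L (c θ) (Γ θ t) - (L (c θ₀) (γ t) - ((θ - θ₀ : ℝ) : ℂ) * (t : ℝ) * I) := by
      have e1 : Continuous fun t : unitInterval => L (c θ) (Γ θ t) :=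
        (hLc _ (hcR θ)).comp_continuous (by fun_prop) (fun t => hθ t trivial)
      have e2 : Continuous fun t : unitInterval => L (c θ₀) (γ t) :=
        (hLc _ (hcR θ₀)).comp_continuous (by fun_prop) hγ
      exact e1.sub (e2.sub (by fun_prop))
    have hγ0 : ∀ t, γ t ≠ 0 := fun t h => h0 _ (h ▸ hγ t)
    have hexp : ∀ t : unitInterval, Complex.exp
        (L (c θ) (Γ θ t) - (L (c θ₀) (γ t) - ((θ - θ₀ : ℝ) : ℂ) * (t : ℝ) * I)) = 1 := by
      intro t
      rw [Complex.exp_sub, hL _ (hcR θ) _ (hθ t trivial), sub_eq_add_neg, Complex.exp_add,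
        hL _ (hcR θ₀) _ (hγ t)]
      exact div_self (mul_ne_zero (hγ0 t) (Complex.exp_ne_zero _))
    have h01 := eq_of_continuous_of_exp_eq hF (fun x y => by rw [hexp, hexp]) 0 1
    have hΓ1 : Γ θ 1 = (c θ)⁻¹ := by
      simp only [hΓ, γ.target, hcinv, mul_assoc, ← Complex.exp_add]
      congr 2
      push_cast
      simp
      ring
    have hΓ0 : Γ θ 0 = s := by simp [hΓ]
    rw [hΓ1, hΓ0, γ.source, γ.target] at h01
    simp only [Set.Icc.coe_zero, Set.Icc.coe_one] at h01
    push_cast at h01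
    simp only [hk]
    linear_combination h01
  have hc0 : c (2 * Real.pi) = c 0 := by simp [hc]
  have := hkconst.apply_eq_of_preconnectedSpace 0 (2 * Real.pi)
  simp only [hk, hc0, Complex.ofReal_zero, zero_mul, sub_zero] at this
  have h2 : ((2 * Real.pi : ℝ) : ℂ) * I = 0 := by linear_combination this
  simp [Real.pi_ne_zero] at h2

/-- A nonvanishing holomorphic function on a disc has a holomorphic logarithm, normalized here
at the centre. -/
lemma exists_differentiableOn_exp_eq {u : ℂ → ℂ} {ρ : ℝ} (hρ : 0 < ρ)
    (hu : DifferentiableOn ℂ u (ball 0 ρ)) (h0 : ∀ z ∈ ball (0 : ℂ) ρ, u z ≠ 0) :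
    ∃ g : ℂ → ℂ, DifferentiableOn ℂ g (ball 0 ρ) ∧ g 0 = 0 ∧
      ∀ z ∈ ball (0 : ℂ) ρ, u z = u 0 * Complex.exp (g z) := by
  have hu' : ∀ z ∈ ball (0 : ℂ) ρ, HasDerivAt u (deriv u z) z := fun z hz =>
    (hu.differentiableAt (isOpen_ball.mem_nhds hz)).hasDerivAt
  have hd : DifferentiableOn ℂ (fun z => deriv u z / u z) (ball 0 ρ) :=
    (hu.deriv isOpen_ball).div hu h0
  obtain ⟨G, hG⟩ := hd.isExactOn_ball
  have hderiv : ∀ z ∈ ball (0 : ℂ) ρ,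
      HasDerivAt (fun z => u z * Complex.exp (-(G z - G 0))) 0 z := by
    intro z hz
    refine ((hu' z hz).mul (((hG z hz).sub_const (G 0)).neg.cexp)).congr_deriv ?_
    have e : u z * (deriv u z / u z) = deriv u z := mul_div_cancel₀ _ (h0 z hz)
    linear_combination -Complex.exp (-(G z - G 0)) * e
  refine ⟨fun z => G z - G 0, fun z hz =>
    ((hG z hz).sub_const _).differentiableAt.differentiableWithinAt, by simp, fun z hz => ?_⟩
  have := isOpen_ball.is_const_of_deriv_eq_zero (convex_ball (0 : ℂ) ρ).isPreconnected
    (fun z hz => (hderiv z hz).differentiableAt.differentiableWithinAt)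
    (fun z hz => (hderiv z hz).deriv) hz (mem_ball_self hρ)
  simp only [sub_self, neg_zero, Complex.exp_zero, mul_one] at this
  rw [← this, mul_assoc, ← Complex.exp_add]
  simp

/-- A Harnack-type estimate for nonvanishing holomorphic functions bounded by one. -/
lemma norm_pow_three_le_norm_zero {u : ℂ → ℂ} {ρ : ℝ} (hu : DifferentiableOn ℂ u (ball 0 ρ))
    (h0 : ∀ z ∈ ball (0 : ℂ) ρ, u z ≠ 0) (h1 : ∀ z ∈ ball (0 : ℂ) ρ, ‖u z‖ ≤ 1)
    {z : ℂ} (hz : z ∈ ball (0 : ℂ) (ρ / 4)) : ‖u z‖ ^ 3 ≤ ‖u 0‖ := by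
  have hzn : ‖z‖ < ρ / 4 := by simpa using hz
  have hρ : 0 < ρ := by linarith [norm_nonneg z]
  have hz' : z ∈ ball (0 : ℂ) ρ := ball_subset_ball (by linarith) hz
  have hu0 : 0 < ‖u 0‖ := norm_pos_iff.2 (h0 0 (mem_ball_self hρ))
  obtain ⟨g, hg, hg0, hgu⟩ := exists_differentiableOn_exp_eq hρ hu h0
  have hre : ∀ w ∈ ball (0 : ℂ) ρ, (g w).re ≤ -Real.log ‖u 0‖ := by
    intro w hw
    have := h1 w hw
    rw [hgu w hw, norm_mul, Complex.norm_exp] at this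
    have := Real.log_le_log (by positivity) this
    rw [Real.log_mul hu0.ne' (Real.exp_ne_zero _), Real.log_exp, Real.log_one] at this
    linarith
  have hM : 0 ≤ -Real.log ‖u 0‖ := by simpa [hg0] using hre 0 (mem_ball_self hρ)
  have key : ∀ M : ℝ, -Real.log ‖u 0‖ < M → (g z).re ≤ 2 / 3 * M := by
    intro M hMM
    have hMpos : 0 < M := hM.trans_lt hMM
    have := Complex.borelCaratheodory_zero hMpos hg
      (fun w hw => (hre w hw).trans hMM.le) hρ hz' hg0
    refine (Complex.re_le_norm _).trans (this.trans ?_)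
    rw [div_le_iff₀ (by linarith)]
    nlinarith
  have hg' : (g z).re ≤ 2 / 3 * -Real.log ‖u 0‖ := by
    refine le_of_forall_pos_le_add fun ε hε => ?_
    linarith [key (-Real.log ‖u 0‖ + ε) (by linarith)]
  rw [hgu z hz', norm_mul, Complex.norm_exp]
  calc (‖u 0‖ * Real.exp (g z).re) ^ 3
      = (Real.exp (Real.log ‖u 0‖ + (g z).re)) ^ 3 := by rw [Real.exp_add, Real.exp_log hu0]
    _ = Real.exp (3 * (Real.log ‖u 0‖ + (g z).re)) := by rw [← Real.exp_nat_mul]; norm_num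
    _ ≤ Real.exp (Real.log ‖u 0‖) := Real.exp_le_exp.2 (by linarith)
    _ = ‖u 0‖ := Real.exp_log hu0

/-- The slices of a ℂ-convex set by complex lines are simply connected, in the affine coordinate
of the line. -/
lemma IsCConvex.isSimplyConnected_slice {n : ℕ} {D : Set (Cn n)} (hcc : IsCConvex D) (p : Cn n)
    {v : Cn n} (hv : v ≠ 0) (hne : ∃ l : ℂ, p + l • v ∈ D) :
    IsSimplyConnected {l : ℂ | p + l • v ∈ D} := by
  have hemb : Topology.IsEmbedding (fun l : ℂ => p + l • v) :=
    (Homeomorph.addLeft p).isEmbedding.comp (isClosedEmbedding_smul_left hv).isEmbedding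
  have himg : (fun l : ℂ => p + l • v) '' {l : ℂ | p + l • v ∈ D} = D ∩ cline p v := by
    ext w
    constructor
    · rintro ⟨l, hl, rfl⟩
      exact ⟨hl, l, rfl⟩
    · rintro ⟨hw, l, rfl⟩
      exact ⟨l, hw, rfl⟩
  rw [← hemb.isSimplyConnected_image, himg]
  obtain ⟨l, hl⟩ := hne
  exact (hcc p v hv ⟨_, hl, l, rfl⟩).2

/-- A ℂ-convex open set does not meet the complex tangent space at a smooth boundary point. -/
lemma IsCConvex.add_notMem_of_tangent {n : ℕ} {D : Set (Cn n)} (hcc : IsCConvex D)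
    (hD : IsOpen D) {p X : Cn n} (hp : p ∉ D) {r : Cn n → ℝ} {r' : Cn n →L[ℝ] ℝ}
    (hr : HasFDerivAt r r' p) (hr0 : r p = 0) (hr' : r' ≠ 0)
    (hneg : ∀ᶠ x in nhds p, r x < 0 → x ∈ D) (hX : ∀ l : ℂ, r' (l • X) = 0) : p + X ∉ D := by
  intro hpX
  obtain ⟨ν, hν⟩ : ∃ ν, r' ν < 0 := by
    obtain ⟨w, hw⟩ : ∃ w, r' w ≠ 0 := by
      by_contra! h
      exact hr' (ContinuousLinearMap.ext h)
    rcases lt_or_gt_of_ne hw with h | h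
    · exact ⟨w, h⟩
    · exact ⟨-w, by simpa using h⟩
  obtain ⟨η, hη, hηD⟩ : ∃ η > 0, ∀ w : ℂ, ‖w‖ < η → p + (X + w • ν) ∈ D := by
    have hopen : IsOpen {w : ℂ | p + (X + w • ν) ∈ D} := hD.preimage (by fun_prop)
    obtain ⟨η, hη, h⟩ := Metric.isOpen_iff.1 hopen 0 (by simpa using hpX)
    exact ⟨η, hη, fun w hw => h (by simpa using hw)⟩
  set R : ℝ := 2 / η with hR
  have hRpos : 0 < R := by positivity
  set C : ℝ := ‖ν‖ + R * ‖X‖ + 1 with hC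
  have hCpos : 0 < C := by positivity
  obtain ⟨d, hd, hdD⟩ : ∃ d > 0, ∀ h : Cn n, ‖h‖ < d →
      r (p + h) - r' h ≤ (-r' ν / (2 * C)) * ‖h‖ ∧ (r (p + h) < 0 → p + h ∈ D) := by
    have h1 := (hr.isLittleO.def (c := -r' ν / (2 * C)) (by
      apply div_pos <;> linarith)).and hneg
    obtain ⟨d, hd, h⟩ := Metric.eventually_nhds_iff.1 h1
    refine ⟨d, hd, fun k hk => ?_⟩
    have := h (y := p + k) (by simpa using hk)
    refine ⟨?_, this.2⟩
    have h2 := (le_abs_self _).trans this.1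
    simpa [hr0] using h2
  set ε : ℝ := d / (2 * C) with hε
  have hεpos : 0 < ε := by positivity
  have hv : ∀ c : ℂ, ‖c‖ = R → ‖ν + c • X‖ ≤ C := by
    intro c hc
    calc ‖ν + c • X‖ ≤ ‖ν‖ + ‖c • X‖ := norm_add_le _ _
      _ ≤ C := by rw [norm_smul, hc]; linarith
  have hsD : ∀ c : ℂ, ‖c‖ = R → p + (ε : ℂ) • (ν + c • X) ∈ D := by
    intro c hc
    have hnorm : ‖(ε : ℂ) • (ν + c • X)‖ ≤ ε * C := by
      rw [norm_smul, Complex.norm_real, Real.norm_eq_abs, abs_of_pos hεpos]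
      exact mul_le_mul_of_nonneg_left (hv c hc) hεpos.le
    have hεC : ε * C = d / 2 := by rw [hε]; field_simp
    obtain ⟨h1, h2⟩ := hdD _ (hnorm.trans_lt (by linarith))
    apply h2
    have h3 : r' ((ε : ℂ) • (ν + c • X)) = ε * r' ν := by
      rw [smul_add, map_add, smul_smul, hX, add_zero, Complex.coe_smul, map_smul, smul_eq_mul]
    have h4 : (-r' ν / (2 * C)) * ‖(ε : ℂ) • (ν + c • X)‖ ≤ (-r' ν / (2 * C)) * (ε * C) :=
      mul_le_mul_of_nonneg_left hnorm (by apply div_nonneg <;> linarith)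
    have h5 : (-r' ν / (2 * C)) * (ε * C) = -(ε * r' ν) / 2 := by field_simp
    have h6 : ε * r' ν < 0 := mul_neg_of_pos_of_neg hεpos hν
    linarith
  refine not_forall_isSimplyConnected_of_mem_inv (fun c => {l : ℂ | p + l • (ν + c • X) ∈ D})
    hRpos (s := ε) ?_ (fun c => by simpa using hp) hsD (fun c hc => ?_) (fun c hc => ?_)
  · exact hD.preimage (f := fun q : ℂ × ℂ => p + q.2 • (ν + q.1 • X)) (by fun_prop)
  · have hc0 : c ≠ 0 := by
      rintro rfl
      simp at hc
      exact hRpos.ne hc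
    have := hηD c⁻¹ (by rw [norm_inv, hc, hR]; simp; linarith)
    simpa [smul_add, smul_smul, hc0, add_comm] using this
  · refine hcc.isSimplyConnected_slice p ?_ ⟨_, hsD c hc⟩
    intro h0
    have := congrArg r' h0
    rw [map_add, hX, map_zero] at this
    linarith

/-- The derivative is nonpositive in a direction along which the function does not increase. -/
lemma HasFDerivAt.apply_nonpos_of_eventually_le {E : Type*} [NormedAddCommGroup E]
    [NormedSpace ℝ E] {r : E → ℝ} {r' : E →L[ℝ] ℝ} {p v : E} (hr : HasFDerivAt r r' p)
    (h : ∀ᶠ s : ℝ in nhdsWithin 0 (Ioi 0), r (p + s • v) ≤ r p) : r' v ≤ 0 := by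
  have hl : HasDerivAt (fun s : ℝ => r (p + s • v)) (r' v) 0 := hr.hasLineDerivAt v
  have ht := (hasDerivAt_iff_tendsto_slope.1 hl).mono_left
    (nhdsWithin_mono 0 (show Ioi (0 : ℝ) ⊆ {0}ᶜ from fun s hs => ne_of_gt hs))
  refine le_of_tendsto ht ?_
  filter_upwards [h, self_mem_nhdsWithin] with s hs hs0
  have hs0' : (0 : ℝ) < s := hs0
  simp only [slope_def_field, sub_zero, zero_smul, add_zero]
  exact div_nonpos_of_nonpos_of_nonneg (by linarith) hs0'.le

/-- If an affine subspace through a point `q` of an open set `D` contains a point outside `D`, then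
there is a first exit point from `D` in this subspace. -/
lemma exists_ball_subset_of_add_notMem {n : ℕ} {D : Set (Cn n)} (hD : IsOpen D)
    (V : Submodule ℂ (Cn n)) {q Y : Cn n} (hq : q ∈ D) (hY : Y ∈ V) (hqY : q + Y ∉ D) :
    ∃ e ∈ V, ‖e‖ = 1 ∧ ∃ δ : ℝ, 0 < δ ∧ δ ≤ ‖Y‖ ∧ q + δ • e ∉ D ∧
      ∀ v ∈ V, ‖v‖ < δ → q + v ∈ D := by
  set S : Set (Cn n) := {v | v ∈ V ∧ q + v ∉ D} with hS
  have hSc : IsClosed S :=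
    V.closed_of_finiteDimensional.inter (hD.isClosed_compl.preimage (by fun_prop))
  obtain ⟨v, ⟨hvV, hvD⟩, hv⟩ := hSc.exists_infDist_eq_dist ⟨Y, hY, hqY⟩ 0
  rw [dist_zero_left] at hv
  have hmin : ∀ w ∈ S, ‖v‖ ≤ ‖w‖ := fun w hw => by
    rw [← hv, ← dist_zero_left w]
    exact Metric.infDist_le_dist_of_mem hw
  have hv0 : v ≠ 0 := by
    rintro rfl
    simp [hq] at hvD
  have hn : 0 < ‖v‖ := norm_pos_iff.2 hv0
  refine ⟨(‖v‖⁻¹ : ℝ) • v, V.smul_of_tower_mem _ hvV, ?_, ‖v‖, hn, hmin Y ⟨hY, hqY⟩, ?_, ?_⟩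
  · rw [norm_smul, norm_inv, norm_norm, inv_mul_cancel₀ hn.ne']
  · rwa [smul_smul, mul_inv_cancel₀ hn.ne', one_smul]
  · intro w hw hlt
    by_contra hwD
    exact hlt.not_ge (hmin w ⟨hw, hwD⟩)

/-- At a smooth first exit point `q + δ • e` from `D` inside `q + V`, the part of `V` orthogonal to
`e` consists of complex tangent vectors, hence leads to points outside `D`. -/
lemma IsCConvex.add_notMem_of_inner_eq_zero {n : ℕ} {D : Set (Cn n)} (hcc : IsCConvex D)
    (hD : IsOpen D) (V : Submodule ℂ (Cn n)) {q e Y : Cn n} {δ : ℝ} (he : e ∈ V)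
    (he1 : ‖e‖ = 1) (hδ : 0 < δ) (hp : q + δ • e ∉ D) (hball : ∀ v ∈ V, ‖v‖ < δ → q + v ∈ D)
    {r : Cn n → ℝ} {r' : Cn n →L[ℝ] ℝ} (hr : HasFDerivAt r r' (q + δ • e))
    (hr0 : r (q + δ • e) = 0) (hr' : r' ≠ 0)
    (hneg : ∀ᶠ x in nhds (q + δ • e), r x < 0 ↔ x ∈ D) (hY : Y ∈ V)
    (hYe : inner ℂ e Y = 0) : q + δ • e + Y ∉ D := by
  refine hcc.add_notMem_of_tangent hD hp hr hr0 hr' (hneg.mono fun x hx => hx.1) ?_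
  have hle : ∀ l : ℂ, ∀ κ : ℝ, 0 < κ → r' (l • Y - κ • e) ≤ 0 := by
    intro l κ hκ
    apply hr.apply_nonpos_of_eventually_le
    set v : Cn n := l • Y - κ • e with hv
    have hvV : v ∈ V := V.sub_mem (V.smul_mem _ hY) (V.smul_of_tower_mem _ he)
    have hinner : inner ℂ e v = -(κ : ℂ) := by
      have : inner ℂ e (κ • e) = (κ : ℂ) := by
        rw [← Complex.coe_smul, inner_smul_right, inner_self_eq_norm_sq_to_K, he1]; simp
      rw [hv, inner_sub_right, inner_smul_right, hYe, this]
      simp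
    have ht : Filter.Tendsto (fun s : ℝ => q + δ • e + s • v) (nhdsWithin 0 (Ioi 0))
        (nhds (q + δ • e)) := by
      have : Continuous fun s : ℝ => q + δ • e + s • v := by fun_prop
      simpa using (this.tendsto 0).mono_left nhdsWithin_le_nhds
    have hsmall : ∀ᶠ s : ℝ in nhdsWithin 0 (Ioi 0), s * ‖v‖ ^ 2 < 2 * δ * κ := by
      have : Continuous fun s : ℝ => s * ‖v‖ ^ 2 := by fun_prop
      exact (this.tendsto 0).mono_left nhdsWithin_le_nhds |>.eventually_lt_const
        (by simp; positivity)
    filter_upwards [ht.eventually hneg, hsmall, self_mem_nhdsWithin] with s hs hs1 hs0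
    have hs0' : (0 : ℝ) < s := hs0
    rw [hr0]
    refine (hs.2 ?_).le
    rw [add_assoc]
    refine hball _ (V.add_mem (V.smul_of_tower_mem _ he) (V.smul_of_tower_mem _ hvV)) ?_
    refine lt_of_pow_lt_pow_left₀ 2 hδ.le ?_
    rw [← Complex.coe_smul, ← Complex.coe_smul, norm_add_sq (𝕜 := ℂ), norm_smul, norm_smul, he1,
      inner_smul_left, inner_smul_right, hinner]
    simp [mul_pow, abs_of_pos hδ, abs_of_pos hs0']
    nlinarith
  have hle0 : ∀ l : ℂ, r' (l • Y) ≤ 0 := by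
    intro l
    have ht : Filter.Tendsto (fun κ : ℝ => r' (l • Y - κ • e)) (nhdsWithin 0 (Ioi 0))
        (nhds (r' (l • Y))) := by
      have : Continuous fun κ : ℝ => r' (l • Y - κ • e) := by fun_prop
      simpa using (this.tendsto 0).mono_left nhdsWithin_le_nhds
    refine le_of_tendsto ht ?_
    filter_upwards [self_mem_nhdsWithin] with κ hκ using hle l κ hκ
  intro l
  have := hle0 (-l)
  rw [neg_smul, map_neg] at this
  linarith [hle0 l]

/-- A holomorphic function on a disc vanishing near the centre vanishes identically. -/
lemma eq_zero_of_eq_zero_on_smaller_ball {E : Type*} [NormedAddCommGroup E] [NormedSpace ℂ E]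
    [CompleteSpace E] {f : ℂ → E} {s ρ : ℝ} (hs : 0 < s) (hsρ : s ≤ ρ)
    (hf : DifferentiableOn ℂ f (ball 0 ρ)) (h : ∀ z ∈ ball (0 : ℂ) s, f z = 0) :
    ∀ z ∈ ball (0 : ℂ) ρ, f z = 0 := by
  refine (hf.analyticOnNhd isOpen_ball).eqOn_zero_of_preconnected_of_eventuallyEq_zero
    (convex_ball (0 : ℂ) ρ).isPreconnected (mem_ball_self (hs.trans_le hsρ)) ?_
  filter_upwards [ball_mem_nhds (0 : ℂ) hs] with z hz using h z hz

/-- Near a boundary point at which `r` increases in direction `ν`, boundary points are pushed into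
`D` by small shifts in direction `-ν`. -/
lemma exists_forall_sub_smul_mem {n : ℕ} {D U : Set (Cn n)} {a : Cn n} (hU : IsOpen U)
    (haU : a ∈ U) {r : Cn n → ℝ} {r' : Cn n →L[ℝ] ℝ} (hr : HasStrictFDerivAt r r' a)
    (hsub : D ∩ U = {x ∈ U | r x < 0}) (hbd : frontier D ∩ U = {x ∈ U | r x = 0})
    {ν : Cn n} (hν : 0 < r' ν) :
    ∃ η > 0, ∀ x ∈ frontier D, ‖x - a‖ < η → ∀ t : ℝ, 0 < t → t < η → x - t • ν ∈ D := by
  have hν0 : 0 < ‖ν‖ := norm_pos_iff.2 (by rintro rfl; simp at hν)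
  have hκ : 0 < r' ν / (2 * ‖ν‖) := by positivity
  have hc : Continuous fun z : Cn n × ℝ => (z.1 - z.2 • ν, z.1) := by fun_prop
  have hc0 : Filter.Tendsto (fun z : Cn n × ℝ => (z.1 - z.2 • ν, z.1)) (nhds (a, 0))
      (nhds (a, a)) := by simpa using hc.tendsto (a, 0)
  have hev := ((hc0.eventually (hr.isLittleO.def hκ)).and
    ((hc0.fst_nhds.eventually (hU.mem_nhds haU)).and (hc0.snd_nhds.eventually (hU.mem_nhds haU))))
  obtain ⟨η, hη, h⟩ := Metric.eventually_nhds_iff.1 hev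
  refine ⟨η, hη, fun x hx hxa t ht htη => ?_⟩
  obtain ⟨h1, h2, h3⟩ := h (y := (x, t)) (by
    simp [dist_eq_norm, hxa, abs_of_pos ht, htη])
  simp only at h1 h2 h3
  have hrx : r x = 0 := (hbd.subset ⟨hx, h3⟩).2
  refine (hsub.superset ⟨h2, ?_⟩).1
  rw [hrx, sub_zero, sub_sub_cancel_left, map_neg, map_smul, norm_neg, norm_smul,
    Real.norm_eq_abs, Real.norm_eq_abs, abs_of_pos ht, smul_eq_mul] at h1
  have h4 := (le_abs_self _).trans h1
  have h5 : r' ν / (2 * ‖ν‖) * (t * ‖ν‖) = t * r' ν / 2 := by field_simp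
  have h6 : 0 < t * r' ν := mul_pos ht hν
  linarith

/-- A unit vector in a finite-dimensional subspace spanned by a holomorphic disc cannot be
almost orthogonal to the disc. -/
lemma exists_pos_forall_not_inner_small {n : ℕ} {f : ℂ → Cn n} {ρ : ℝ} (hρ : 0 < ρ)
    (hf : DifferentiableOn ℂ f (ball 0 ρ)) :
    ∃ δ₀ > 0, ∀ e ∈ Submodule.span ℂ (f '' ball 0 ρ), ‖e‖ = 1 → ∀ δ : ℝ, 0 < δ → δ < δ₀ →
      ¬ ∀ z ∈ ball (0 : ℂ) (ρ / 4), ‖inner ℂ e (f z) - δ‖ ^ 3 ≤ δ := by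
  by_contra! hcon
  choose! e heV he1 δ hδ hδ₀ h using fun j : ℕ => hcon (1 / ((j : ℝ) + 1)) (by positivity)
  set V := Submodule.span ℂ (f '' ball 0 ρ) with hV
  have hδ0 : Filter.Tendsto δ Filter.atTop (nhds 0) :=
    squeeze_zero (fun j => (hδ j).le) (fun j => (hδ₀ j).le) tendsto_one_div_add_atTop_nhds_zero_nat
  obtain ⟨e', he', ψ, hψ, hlim⟩ := (isCompact_sphere (0 : Cn n) 1).tendsto_subseq
    (x := e) (fun j => by simp [he1 j])
  have he'V : e' ∈ V := V.closed_of_finiteDimensional.mem_of_tendsto hlim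
    (Filter.Eventually.of_forall fun j => heV _)
  have hzero : ∀ z ∈ ball (0 : ℂ) (ρ / 4), inner ℂ e' (f z) = 0 := by
    intro z hz
    have h1 : Filter.Tendsto (fun j => ‖inner ℂ (e (ψ j)) (f z) - (δ (ψ j) : ℂ)‖ ^ 3)
        Filter.atTop (nhds (‖inner ℂ e' (f z) - ((0 : ℝ) : ℂ)‖ ^ 3)) := by
      have h2 : Filter.Tendsto (fun j => ((δ (ψ j) : ℝ) : ℂ)) Filter.atTop
          (nhds ((0 : ℝ) : ℂ)) :=
        (Complex.continuous_ofReal.tendsto 0).comp (hδ0.comp hψ.tendsto_atTop)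
      exact (((hlim.inner tendsto_const_nhds).sub h2).norm).pow 3
    have h3 := le_of_tendsto_of_tendsto' h1 (hδ0.comp hψ.tendsto_atTop) (fun j => h _ z hz)
    have h4 : ‖inner ℂ e' (f z)‖ ^ 3 = 0 := le_antisymm (by simpa using h3) (by positivity)
    simpa using h4
  have hall := eq_zero_of_eq_zero_on_smaller_ball (f := fun z => inner ℂ e' (f z))
    (by positivity : 0 < ρ / 4) (by linarith)
    ((innerSL ℂ e').differentiable.comp_differentiableOn hf) hzero
  have hperp : ∀ v ∈ V, inner ℂ e' v = 0 := by
    intro v hv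
    induction hv using Submodule.span_induction with
    | mem x hx =>
      obtain ⟨z, hz, rfl⟩ := hx
      exact hall z hz
    | zero => simp
    | add x y _ _ hx hy => rw [inner_add_right, hx, hy, add_zero]
    | smul c x _ hx => rw [inner_smul_right, hx, mul_zero]
  have : e' = 0 := inner_self_eq_zero.1 (hperp e' he'V)
  simp [this] at he'

/-- If the boundary contains a holomorphic disc through the smooth point `a`, then inward shifts of
`a` have uniformly large neighbourhoods in `D` in the directions spanned by the disc. -/
lemma IsCConvex.exists_uniform_ball_subset {n : ℕ} {D U : Set (Cn n)} (hcc : IsCConvex D)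
    (hD : IsOpen D) {a : Cn n} (hU : IsOpen U) (haU : a ∈ U) {r : Cn n → ℝ}
    (hr : ContDiffOn ℝ 1 r U) (hgrad : ∀ x ∈ U, fderiv ℝ r x ≠ 0)
    (hsub : D ∩ U = {x ∈ U | r x < 0}) (hbd : frontier D ∩ U = {x ∈ U | r x = 0})
    {φ : ℂ → Cn n} {ρ η : ℝ} (hρ : 0 < ρ) (hη : 0 < η) (hφ : DifferentiableOn ℂ φ (ball 0 ρ))
    (hφ0 : φ 0 = a) (hφb : ∀ z ∈ ball (0 : ℂ) ρ, ‖φ z - a‖ ≤ 1 / 2) {ν : Cn n}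
    (hν : ∀ z ∈ ball (0 : ℂ) ρ, ∀ t : ℝ, 0 < t → t < η → φ z - t • ν ∈ D) :
    ∃ δ₀ > 0, ∀ t : ℝ, 0 < t → t < δ₀ →
      ∀ Y ∈ Submodule.span ℂ ((fun z => φ z - a) '' ball 0 ρ), ‖Y‖ < δ₀ → a - t • ν + Y ∈ D := by
  obtain ⟨δ₁, hδ₁, hsmall⟩ := exists_pos_forall_not_inner_small hρ (hφ.sub_const a)
  set V := Submodule.span ℂ ((fun z => φ z - a) '' ball 0 ρ) with hV
  have hUev : ∀ᶠ z : ℝ × Cn n in nhds (0, 0), a - z.1 • ν + z.2 ∈ U := by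
    have hc : Continuous fun z : ℝ × Cn n => a - z.1 • ν + z.2 := by fun_prop
    exact (hc.tendsto (0, 0)).eventually (hU.mem_nhds (by simpa using haU))
  obtain ⟨d, hd, hdU⟩ := Metric.eventually_nhds_iff.1 hUev
  refine ⟨min (min δ₁ η) (min d (1 / 2)), by positivity, fun t ht htlt Y hY hYlt => ?_⟩
  simp only [lt_min_iff] at htlt hYlt
  by_contra hnot
  have hq : a - t • ν ∈ D := hφ0 ▸ hν 0 (mem_ball_self hρ) t ht htlt.1.2
  obtain ⟨e, heV, he1, δ, hδ, hδY, hp, hball⟩ :=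
    exists_ball_subset_of_add_notMem hD V hq hY hnot
  set p : Cn n := a - t • ν + δ • e with hpdef
  have hpU : p ∈ U := hdU (y := (t, δ • e)) (by
    have : ‖δ • e‖ < d := by
      rw [norm_smul, he1, mul_one, Real.norm_eq_abs, abs_of_pos hδ]; linarith
    simp [Prod.dist_eq, abs_of_pos ht, htlt.2.1, this])
  have hpcl : p ∈ closure D := by
    have hc : Continuous fun s : ℝ => a - t • ν + s • e := by fun_prop
    refine mem_closure_of_tendsto (b := nhdsWithin δ (Iio δ))
      ((hc.tendsto δ).mono_left nhdsWithin_le_nhds) ?_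
    have hpos : ∀ᶠ s in nhdsWithin δ (Iio δ), 0 < s :=
      nhdsWithin_le_nhds (lt_mem_nhds hδ)
    filter_upwards [self_mem_nhdsWithin, hpos] with s hs hs0
    refine hball _ (V.smul_of_tower_mem _ heV) ?_
    rw [norm_smul, he1, mul_one, Real.norm_eq_abs, abs_of_pos hs0]
    exact hs
  have hpfr : p ∈ frontier D := by
    rw [hD.frontier_eq]
    exact ⟨hpcl, hp⟩
  have hrp : r p = 0 := (hbd.subset ⟨hpfr, hpU⟩).2
  have hder : HasFDerivAt r (fderiv ℝ r p) p :=
    ((hr.contDiffAt (hU.mem_nhds hpU)).differentiableAt one_ne_zero).hasFDerivAt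
  have hneg : ∀ᶠ x in nhds p, r x < 0 ↔ x ∈ D := by
    filter_upwards [hU.mem_nhds hpU] with x hx
    exact ⟨fun h => (hsub.superset ⟨hx, h⟩).1, fun h => (hsub.subset ⟨h, hx⟩).2⟩
  have hfV : ∀ z ∈ ball (0 : ℂ) ρ, φ z - a ∈ V := fun z hz =>
    Submodule.subset_span ⟨z, hz, rfl⟩
  refine hsmall e heV he1 δ hδ (by linarith) fun z hz => ?_
  have hρz := norm_pow_three_le_norm_zero (u := fun z => inner ℂ e (φ z - a) - (δ : ℂ)) (ρ := ρ)
    (((innerSL ℂ e).differentiable.comp_differentiableOn (hφ.sub_const a)).sub_const _)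
    ?_ ?_ hz
  · simpa [hφ0, abs_of_pos hδ] using hρz
  · intro z hz hz0
    have hY' : φ z - a - δ • e ∈ V := V.sub_mem (hfV z hz) (V.smul_of_tower_mem _ heV)
    refine hcc.add_notMem_of_inner_eq_zero hD V heV he1 hδ hp hball hder hrp (hgrad p hpU) hneg
      hY' ?_ ?_
    · rw [inner_sub_right, ← Complex.coe_smul, inner_smul_right, inner_self_eq_norm_sq_to_K, he1]
      simpa [inner_sub_right] using hz0
    · convert hν z hz t ht htlt.1.2 using 1
      abel
  · intro z hz
    have h1 : ‖inner ℂ e (φ z - a)‖ ≤ 1 / 2 := by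
      refine (norm_inner_le_norm _ _).trans ?_
      rw [he1, one_mul]
      exact hφb z hz
    refine (norm_sub_le _ _).trans ?_
    rw [Complex.norm_real, Real.norm_eq_abs, abs_of_pos hδ]
    linarith

/-- For a `C¹`-smooth boundary point `a` of a ℂ-convex domain `D`:
there is a nonconstant analytic disc in `∂D` through `a` if and only if there is a
nonzero `X` and `ε > 0` with `{a + λX : |λ| < ε} ⊆ ∂D`. -/
theorem statement8 {n : ℕ} (D : Set (Cn n)) (hD : IsDomain' D) (hcc : IsCConvex D)
    (a : Cn n) (ha : a ∈ frontier D)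
    (U : Set (Cn n)) (hU : IsOpen U) (haU : a ∈ U) (r : Cn n → ℝ)
    (hr : ContDiffOn ℝ 1 r U) (hgrad : ∀ x ∈ U, fderiv ℝ r x ≠ 0)
    (hsub : D ∩ U = {x ∈ U | r x < 0})
    (hbd : frontier D ∩ U = {x ∈ U | r x = 0}) :
    (∃ φ : ℂ → Cn n, DifferentiableOn ℂ φ (Metric.ball (0:ℂ) 1) ∧
        Set.MapsTo φ (Metric.ball (0:ℂ) 1) (frontier D) ∧ φ 0 = a ∧
        ∃ w ∈ Metric.ball (0:ℂ) 1, φ w ≠ a) ↔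
      (∃ X : Cn n, X ≠ 0 ∧ ∃ ε > (0:ℝ), ∀ l : ℂ, ‖l‖ < ε → a + l • X ∈ frontier D) := by
  obtain ⟨hDo, -⟩ := hD
  constructor
  · rintro ⟨φ, hφ, hφD, hφ0, w, hw, hwa⟩
    have haD : a ∉ D := by
      rw [hDo.frontier_eq] at ha
      exact ha.2
    have hra : r a = 0 := (hbd.subset ⟨ha, haU⟩).2
    have hstrict : HasStrictFDerivAt r (fderiv ℝ r a) a :=
      (hr.contDiffAt (hU.mem_nhds haU)).hasStrictFDerivAt one_ne_zero
    obtain ⟨ν, hν⟩ : ∃ ν, 0 < fderiv ℝ r a ν := by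
      obtain ⟨x, hx⟩ : ∃ x, fderiv ℝ r a x ≠ 0 := by
        by_contra! h
        exact hgrad a haU (ContinuousLinearMap.ext h)
      rcases lt_or_gt_of_ne hx with h | h
      · exact ⟨-x, by simpa using h⟩
      · exact ⟨x, h⟩
    obtain ⟨η, hη, hinn⟩ := exists_forall_sub_smul_mem hU haU hstrict hsub hbd hν
    obtain ⟨s, hs, hsφ⟩ : ∃ s > 0, ∀ z ∈ ball (0 : ℂ) s, ‖φ z - a‖ < min η (1 / 2) := by
      have hcont : ContinuousAt φ 0 :=
        (hφ.differentiableAt (ball_mem_nhds _ one_pos)).continuousAt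
      obtain ⟨s, hs, h⟩ := Metric.continuousAt_iff.1 hcont (min η (1 / 2)) (by positivity)
      exact ⟨s, hs, fun z hz => by simpa [hφ0, dist_eq_norm] using h hz⟩
    set ρ := min s 1 with hρdef
    have hρ : 0 < ρ := by positivity
    have hρs : ball (0 : ℂ) ρ ⊆ ball 0 s := ball_subset_ball (min_le_left _ _)
    have hρ1 : ball (0 : ℂ) ρ ⊆ ball 0 1 := ball_subset_ball (min_le_right _ _)
    obtain ⟨δ₀, hδ₀, hunif⟩ := hcc.exists_uniform_ball_subset hDo hU haU hr hgrad hsub hbd hρ hη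
      (hφ.mono hρ1) hφ0 (fun z hz => ((hsφ z (hρs hz)).trans_le (min_le_right _ _)).le)
      (fun z hz => hinn _ (hφD (hρ1 hz)) ((hsφ z (hρs hz)).trans_le (min_le_left _ _)))
    set V := Submodule.span ℂ ((fun z => φ z - a) '' ball 0 ρ) with hV
    obtain ⟨X, hXV, hX0⟩ : ∃ X ∈ V, X ≠ 0 := by
      by_contra! h
      exact hwa (sub_eq_zero.1 (eq_zero_of_eq_zero_on_smaller_ball hρ (min_le_right _ _)
        (hφ.sub_const a) (fun z hz => h _ (Submodule.subset_span ⟨z, hz, rfl⟩)) w hw))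
    have hcl : ∀ Y ∈ V, ‖Y‖ < δ₀ → a + Y ∈ closure D := by
      intro Y hY hYlt
      have hc : Continuous fun t : ℝ => a - t • ν + Y := by fun_prop
      refine mem_closure_of_tendsto (f := fun t : ℝ => a - t • ν + Y) (b := nhdsWithin 0 (Ioi 0))
        (by simpa using (hc.tendsto 0).mono_left nhdsWithin_le_nhds) ?_
      have hlt : ∀ᶠ t in nhdsWithin (0 : ℝ) (Ioi 0), t < δ₀ :=
        nhdsWithin_le_nhds (gt_mem_nhds hδ₀)
      filter_upwards [self_mem_nhdsWithin, hlt] with t ht ht'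
      exact hunif t ht ht' Y hY hYlt
    have hle : ∀ Y ∈ V, fderiv ℝ r a Y ≤ 0 := by
      intro Y hY
      apply hstrict.hasFDerivAt.apply_nonpos_of_eventually_le
      have hc : Continuous fun s : ℝ => a + s • Y := by fun_prop
      have hUe : ∀ᶠ s in nhdsWithin (0 : ℝ) (Ioi 0), a + s • Y ∈ U :=
        nhdsWithin_le_nhds ((hc.tendsto 0).eventually (hU.mem_nhds (by simpa using haU)))
      have hn : ∀ᶠ s in nhdsWithin (0 : ℝ) (Ioi 0), ‖s • Y‖ < δ₀ := by
        have hc' : Continuous fun s : ℝ => ‖s • Y‖ := by fun_prop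
        exact nhdsWithin_le_nhds ((hc'.tendsto 0).eventually (gt_mem_nhds (by simpa using hδ₀)))
      filter_upwards [hUe, hn] with s hsU hsn
      rw [hra]
      have hmem := hcl _ (V.smul_of_tower_mem s hY) hsn
      rw [closure_eq_self_union_frontier] at hmem
      rcases hmem with h | h
      · exact (hsub.subset ⟨h, hsU⟩).2.le
      · exact (hbd.subset ⟨h, hsU⟩).2.le
    have hzero : ∀ Y ∈ V, fderiv ℝ r a Y = 0 := by
      intro Y hY
      have := hle _ (V.neg_mem hY)
      rw [map_neg] at this
      linarith [hle Y hY]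
    have hout : ∀ Y ∈ V, a + Y ∉ D := by
      intro Y hY
      refine hcc.add_notMem_of_tangent hDo haD hstrict.hasFDerivAt hra (hgrad a haU) ?_
        (fun l => hzero _ (V.smul_mem l hY))
      filter_upwards [hU.mem_nhds haU] with x hx h
      exact (hsub.superset ⟨hx, h⟩).1
    have hXn : 0 < ‖X‖ := norm_pos_iff.2 hX0
    refine ⟨X, hX0, δ₀ / ‖X‖, by positivity, fun l hl => ?_⟩
    rw [hDo.frontier_eq]
    refine ⟨hcl _ (V.smul_mem l hXV) ?_, hout _ (V.smul_mem l hXV)⟩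
    rwa [norm_smul, ← lt_div_iff₀ hXn]
  · rintro ⟨X, hX0, ε, hε, h⟩
    refine ⟨fun z => a + ((ε : ℂ) * z) • X, by fun_prop, fun z hz => h _ ?_, by simp,
      1 / 2, by simp; norm_num, by simp [hX0, hε.ne']⟩
    rw [norm_mul, Complex.norm_real, Real.norm_eq_abs, abs_of_pos hε]
    have : ‖z‖ < 1 := by simpa using hz
    nlinarith

end
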